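/- (Lemma 3.24) For any positive polarized formula P and unpolarized structure Γ: if Γ, ⌈Σ⌉ ⊢ is derivable in the unpolarized sequent calculus for every Σ ∈ τ*(P), then Γ, ⌈P⌉ ⊢ is derivable. -/

import Mathlib

/-- Unpolarized formulas of LG/CNL.  `ldiv B A` denotes `B\A`, `lsub B A` denotes `B⦸A`,
`rdiv A B` denotes `A/B`, `rsub A B` denotes `A⊘B`. -/
inductive Fm : Type
  | pos : Nat → Fm                -- positive atom p
  | neg : Nat → Fm                -- negative atom p̄
  | tens : Fm → Fm → Fm           -- A ⊗ B
  | par : Fm → Fm → Fm            -- A ⊕ B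
  | rdiv : Fm → Fm → Fm           -- A / B
  | ldiv : Fm → Fm → Fm           -- B \ A  (ldiv B A)
  | rsub : Fm → Fm → Fm           -- A ⊘ B
  | lsub : Fm → Fm → Fm           -- B ⦸ A  (lsub B A)
  | conj : Fm → Fm → Fm           -- A ∧ B
  | disj : Fm → Fm → Fm           -- A ∨ B

/-- Linear negation. -/
def Fm.dual : Fm → Fm
  | .pos n => .neg n
  | .neg n => .pos n
  | .tens A B => .par B.dual A.dual        -- (A⊗B)⊥ = B⊥⊕A⊥
  | .par A B => .tens B.dual A.dual        -- (A⊕B)⊥ = B⊥⊗A⊥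
  | .rdiv A B => .lsub B.dual A.dual       -- (A/B)⊥ = B⊥⦸A⊥
  | .lsub B A => .rdiv A.dual B.dual       -- (B⦸A)⊥ = A⊥/B⊥
  | .ldiv B A => .rsub A.dual B.dual       -- (B\A)⊥ = A⊥⊘B⊥
  | .rsub A B => .ldiv B.dual A.dual       -- (A⊘B)⊥ = B⊥\A⊥
  | .conj A B => .disj B.dual A.dual       -- (A∧B)⊥ = B⊥∨A⊥
  | .disj A B => .conj B.dual A.dual       -- (A∨B)⊥ = B⊥∧A⊥
/-- Structures: Γ ::= A | Γ·⊗·Δ | Γ·⊘·Δ | Δ·⦸·Γ.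
`slsub Δ Γ` denotes `Δ·⦸·Γ`, `srsub Γ Δ` denotes `Γ·⊘·Δ`. -/
inductive Str : Type
  | fm : Fm → Str
  | stens : Str → Str → Str
  | srsub : Str → Str → Str
  | slsub : Str → Str → Str

mutual
/-- The positive formula interpretation Γ⁺ of a structure. -/
def Str.posF : Str → Fm
  | .fm A => A
  | .stens Γ Δ => .tens Γ.posF Δ.posF
  | .srsub Γ Δ => .rsub Γ.posF Δ.negF
  | .slsub Δ Γ => .lsub Δ.negF Γ.posF
/-- The negative formula interpretation Γ⁻ of a structure. -/
def Str.negF : Str → Fm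
  | .fm A => A.dual
  | .stens Γ Δ => .par Δ.negF Γ.negF
  | .srsub Γ Δ => .ldiv Δ.posF Γ.negF
  | .slsub Δ Γ => .rdiv Γ.negF Δ.posF
end

/-- One-sided sequent derivability `DSeq g c Γ Δ` of the presentation `Γ,Δ ⊢`.
The flag `g` enables the Grishin (linear distributivity) structural rules of LG_I,
the flag `c` enables the CNL structural rules.  Thus `DSeq false false` is LG∅,
`DSeq true false` is LG_I, and `DSeq false true` is CNL. -/
inductive DSeq : Bool → Bool → Str → Str → Prop
  | ax {g c A} : DSeq g c (.fm A) (.fm A.dual)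
  | cut {g c Γ Δ A} : DSeq g c Δ (.fm A) → DSeq g c Γ (.fm A.dual) → DSeq g c Γ Δ
  | sym {g c Γ Δ} : DSeq g c Γ Δ → DSeq g c Δ Γ
  | dp1 {g c Γ Δ Θ} : DSeq g c (.stens Γ Δ) Θ → DSeq g c Γ (.slsub Δ Θ)
  | dp1' {g c Γ Δ Θ} : DSeq g c Γ (.slsub Δ Θ) → DSeq g c (.stens Γ Δ) Θ
  | dp2 {g c Γ Δ Θ} : DSeq g c Γ (.stens Δ Θ) → DSeq g c (.srsub Γ Δ) Θ
  | dp2' {g c Γ Δ Θ} : DSeq g c (.srsub Γ Δ) Θ → DSeq g c Γ (.stens Δ Θ)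
  | tensL {g c Γ A B} : DSeq g c Γ (.stens (.fm A) (.fm B)) → DSeq g c Γ (.fm (.tens A B))
  | lsubL {g c Γ A B} : DSeq g c Γ (.slsub (.fm B.dual) (.fm A)) → DSeq g c Γ (.fm (.lsub B A))
  | rsubL {g c Γ A B} : DSeq g c Γ (.srsub (.fm A) (.fm B.dual)) → DSeq g c Γ (.fm (.rsub A B))
  | parL {g c Γ Δ A B} : DSeq g c Γ (.fm A) → DSeq g c Δ (.fm B) →
      DSeq g c (.stens Δ Γ) (.fm (.par A B))
  | rdivL {g c Γ Δ A B} : DSeq g c Δ (.fm B.dual) → DSeq g c Γ (.fm A) →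
      DSeq g c (.slsub Δ Γ) (.fm (.rdiv A B))
  | ldivL {g c Γ Δ A B} : DSeq g c Δ (.fm B.dual) → DSeq g c Γ (.fm A) →
      DSeq g c (.srsub Γ Δ) (.fm (.ldiv B A))
  | conjL1 {g c Γ A B} : DSeq g c Γ (.fm A) → DSeq g c Γ (.fm (.conj A B))
  | conjL2 {g c Γ A B} : DSeq g c Γ (.fm B) → DSeq g c Γ (.fm (.conj A B))
  | disjL {g c Γ A B} : DSeq g c Γ (.fm A) → DSeq g c Γ (.fm B) → DSeq g c Γ (.fm (.disj A B))
  -- Grishin structural rules (LG_I)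
  | gr1 {c Γ₁ Γ₂ Δ₁ Δ₂} : DSeq true c (.srsub Γ₂ Δ₂) (.srsub Δ₁ Γ₁) →
      DSeq true c (.stens Γ₁ Γ₂) (.stens Δ₂ Δ₁)
  | gr2 {c Γ₁ Γ₂ Δ₁ Δ₂} : DSeq true c (.slsub Δ₁ Γ₁) (.slsub Γ₂ Δ₂) →
      DSeq true c (.stens Γ₁ Γ₂) (.stens Δ₂ Δ₁)
  | gr3 {c Γ₁ Γ₂ Δ₁ Δ₂} : DSeq true c (.srsub Δ₂ Γ₁) (.slsub Δ₁ Γ₂) →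
      DSeq true c (.stens Γ₁ Γ₂) (.stens Δ₂ Δ₁)
  -- CNL structural rules
  | cnl1 {g Γ Δ Θ} : DSeq g true Γ (.srsub Δ Θ) → DSeq g true Γ (.stens Δ Θ)
  | cnl1' {g Γ Δ Θ} : DSeq g true Γ (.stens Δ Θ) → DSeq g true Γ (.srsub Δ Θ)
  | cnl2 {g Γ Δ Θ} : DSeq g true Γ (.slsub Δ Θ) → DSeq g true Γ (.stens Δ Θ)
  | cnl2' {g Γ Δ Θ} : DSeq g true Γ (.stens Δ Θ) → DSeq g true Γ (.slsub Δ Θ)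
mutual
/-- Positive polarized formulas.  `rsub P N` denotes `P⊘N`, `lsub N P` denotes `N⦸P`. -/
inductive PFm : Type
  | pos : Nat → PFm               -- atom p
  | tens : PFm → PFm → PFm        -- P ⊗ Q
  | rsub : PFm → NFm → PFm        -- P ⊘ N
  | lsub : NFm → PFm → PFm        -- N ⦸ P
  | disj : PFm → PFm → PFm        -- P ∨ Q
  | down : NFm → PFm              -- ↓N
/-- Negative polarized formulas.  `rdiv M Q` denotes `M/Q`, `ldiv Q M` denotes `Q\M`. -/
inductive NFm : Type
  | neg : Nat → NFm               -- atom p̄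
  | par : NFm → NFm → NFm         -- M ⊕ N
  | ldiv : PFm → NFm → NFm        -- Q \ M
  | rdiv : NFm → PFm → NFm        -- M / Q
  | conj : NFm → NFm → NFm        -- M ∧ N
  | up : PFm → NFm                -- ↑P
end

mutual
/-- Polarized linear negation (positive to negative). -/
def PFm.dual : PFm → NFm
  | .pos n => .neg n
  | .tens P Q => .par Q.dual P.dual        -- (P⊗Q)⊥ = Q⊥⊕P⊥
  | .rsub P N => .ldiv N.dual P.dual       -- (P⊘N)⊥ = N⊥\P⊥
  | .lsub N P => .rdiv P.dual N.dual       -- (N⦸P)⊥ = P⊥/N⊥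
  | .disj P Q => .conj Q.dual P.dual       -- (P∨Q)⊥ = Q⊥∧P⊥
  | .down N => .up N.dual                  -- (↓N)⊥ = ↑(N⊥)
/-- Polarized linear negation (negative to positive). -/
def NFm.dual : NFm → PFm
  | .neg n => .pos n
  | .par M N => .tens N.dual M.dual        -- (M⊕N)⊥ = N⊥⊗M⊥
  | .ldiv Q M => .rsub M.dual Q.dual       -- (Q\M)⊥ = M⊥⊘Q⊥
  | .rdiv M Q => .lsub Q.dual M.dual       -- (M/Q)⊥ = Q⊥⦸M⊥
  | .conj M N => .disj N.dual M.dual       -- (M∧N)⊥ = N⊥∨M⊥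
  | .up P => .down P.dual                  -- (↑P)⊥ = ↓(P⊥)
end
/-- Focused structures: π ::= p | N | π·⊗·σ | π·⊘·σ | σ·⦸·π, where a negative formula `N`
stands for its implicit ↓-shift.  `slsub σ π` denotes `σ·⦸·π`, `srsub π σ` denotes `π·⊘·σ`. -/
inductive FStr : Type
  | at : Nat → FStr
  | nfm : NFm → FStr
  | stens : FStr → FStr → FStr
  | srsub : FStr → FStr → FStr
  | slsub : FStr → FStr → FStr

/-- The decomposition relation `Tstar P σ`, i.e. `σ ∈ τ*(P)`:
τ*(P⊗Q)={π·⊗·σ | π∈τ*(P), σ∈τ*(Q)}, τ*(P⊘N)={π·⊘·σ | π∈τ*(P), σ∈τ*(N⊥)},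
τ*(N⦸P)={σ·⦸·π | π∈τ*(P), σ∈τ*(N⊥)}, τ*(P∨Q)=τ*(P)∪τ*(Q), τ*(p)={p}, τ*(↓N)={N}. -/
inductive Tstar : PFm → FStr → Prop
  | tens {P Q π σ} : Tstar P π → Tstar Q σ → Tstar (.tens P Q) (.stens π σ)
  | rsub {P N π σ} : Tstar P π → Tstar N.dual σ → Tstar (.rsub P N) (.srsub π σ)
  | lsub {N P π σ} : Tstar P π → Tstar N.dual σ → Tstar (.lsub N P) (.slsub σ π)
  | disjl {P Q π} : Tstar P π → Tstar (.disj P Q) π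
  | disjr {P Q π} : Tstar Q π → Tstar (.disj P Q) π
  | at {n} : Tstar (.pos n) (.at n)
  | down {N} : Tstar (.down N) (.nfm N)
mutual
/-- The forgetful map ⌈·⌉ erasing shifts (on positive formulas). -/
def forgetP : PFm → Fm
  | .pos n => .pos n
  | .tens P Q => .tens (forgetP P) (forgetP Q)
  | .rsub P N => .rsub (forgetP P) (forgetN N)
  | .lsub N P => .lsub (forgetN N) (forgetP P)
  | .disj P Q => .disj (forgetP P) (forgetP Q)
  | .down N => forgetN N
/-- The forgetful map ⌈·⌉ erasing shifts (on negative formulas). -/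
def forgetN : NFm → Fm
  | .neg n => .neg n
  | .par M N => .par (forgetN M) (forgetN N)
  | .ldiv Q M => .ldiv (forgetP Q) (forgetN M)
  | .rdiv M Q => .rdiv (forgetN M) (forgetP Q)
  | .conj M N => .conj (forgetN M) (forgetN N)
  | .up P => forgetP P
end

/-- The forgetful map ⌈·⌉ on focused structures. -/
def forgetFS : FStr → Str
  | .at n => .fm (.pos n)
  | .nfm N => .fm (forgetN N)
  | .stens π σ => .stens (forgetFS π) (forgetFS σ)
  | .srsub π σ => .srsub (forgetFS π) (forgetFS σ)
  | .slsub σ π => .slsub (forgetFS σ) (forgetFS π)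

mutual
theorem PFm.dual_dual' : ∀ P : PFm, P.dual.dual = P
  | .pos n => by simp [PFm.dual, NFm.dual]
  | .tens P Q => by simp [PFm.dual, NFm.dual, PFm.dual_dual' P, PFm.dual_dual' Q]
  | .rsub P N => by simp [PFm.dual, NFm.dual, PFm.dual_dual' P, NFm.dual_dual' N]
  | .lsub N P => by simp [PFm.dual, NFm.dual, PFm.dual_dual' P, NFm.dual_dual' N]
  | .disj P Q => by simp [PFm.dual, NFm.dual, PFm.dual_dual' P, PFm.dual_dual' Q]
  | .down N => by simp [PFm.dual, NFm.dual, NFm.dual_dual' N]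
theorem NFm.dual_dual' : ∀ N : NFm, N.dual.dual = N
  | .neg n => by simp [PFm.dual, NFm.dual]
  | .par M N => by simp [PFm.dual, NFm.dual, NFm.dual_dual' M, NFm.dual_dual' N]
  | .ldiv P N => by simp [PFm.dual, NFm.dual, PFm.dual_dual' P, NFm.dual_dual' N]
  | .rdiv N P => by simp [PFm.dual, NFm.dual, PFm.dual_dual' P, NFm.dual_dual' N]
  | .conj M N => by simp [PFm.dual, NFm.dual, NFm.dual_dual' M, NFm.dual_dual' N]
  | .up P => by simp [PFm.dual, NFm.dual, PFm.dual_dual' P]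
end

mutual
theorem forget_dualP : ∀ P : PFm, forgetN P.dual = (forgetP P).dual
  | .pos n => by simp [PFm.dual, forgetN, forgetP, Fm.dual]
  | .tens P Q => by simp [PFm.dual, forgetN, forgetP, Fm.dual, forget_dualP P, forget_dualP Q]
  | .rsub P N => by simp [PFm.dual, forgetN, forgetP, Fm.dual, forget_dualP P, forget_dualN N]
  | .lsub N P => by simp [PFm.dual, forgetN, forgetP, Fm.dual, forget_dualP P, forget_dualN N]
  | .disj P Q => by simp [PFm.dual, forgetN, forgetP, Fm.dual, forget_dualP P, forget_dualP Q]
  | .down N => by simp [PFm.dual, forgetN, forgetP, forget_dualN N]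
theorem forget_dualN : ∀ N : NFm, forgetP N.dual = (forgetN N).dual
  | .neg n => by simp [NFm.dual, forgetN, forgetP, Fm.dual]
  | .par M N => by simp [NFm.dual, forgetN, forgetP, Fm.dual, forget_dualN M, forget_dualN N]
  | .ldiv P N => by simp [NFm.dual, forgetN, forgetP, Fm.dual, forget_dualP P, forget_dualN N]
  | .rdiv N P => by simp [NFm.dual, forgetN, forgetP, Fm.dual, forget_dualP P, forget_dualN N]
  | .conj M N => by simp [NFm.dual, forgetN, forgetP, Fm.dual, forget_dualN M, forget_dualN N]
  | .up P => by simp [NFm.dual, forgetN, forgetP, forget_dualP P]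
end

/-- The inversion property for a positive formula. -/
def GoodP (P : PFm) : Prop := ∀ Γ : Str,
  (∀ σ : FStr, Tstar P σ → DSeq false false Γ (forgetFS σ)) → DSeq false false Γ (.fm (forgetP P))

theorem good_tens {P Q : PFm} (hP : GoodP P) (hQ : GoodP Q) : GoodP (.tens P Q) := by
  intro Γ h
  rw [forgetP]
  refine .tensL (.sym (.dp1' (.sym (hP _ fun π hπ => .sym (.dp1 (.sym (.dp2' (hQ _ fun σ hσ => ?_))))))))
  exact .dp2 (h _ (.tens hπ hσ))

theorem good_rsub {P : PFm} {N : NFm} (hP : GoodP P) (hN : GoodP N.dual) : GoodP (.rsub P N) := by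
  intro Γ h
  rw [forgetP]
  refine .rsubL ?_
  rw [← forget_dualN]
  refine .sym (.dp2 (.sym (.dp1' (.sym (hN _ fun σ hσ => .sym (.dp1 (hP _ fun π hπ => ?_)))))))
  exact .sym (.dp2' (.sym (h _ (.rsub hπ hσ))))

theorem good_lsub {P : PFm} {N : NFm} (hP : GoodP P) (hN : GoodP N.dual) : GoodP (.lsub N P) := by
  intro Γ h
  rw [forgetP]
  refine .lsubL ?_
  rw [← forget_dualN]
  refine .dp1 (.sym (.dp2' (hN _ fun σ hσ => .dp2 (.sym (hP _ fun π hπ => ?_)))))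
  exact .dp1' (h _ (.lsub hπ hσ))

theorem good_disj {P Q : PFm} (hP : GoodP P) (hQ : GoodP Q) : GoodP (.disj P Q) := by
  intro Γ h
  rw [forgetP]
  exact .disjL (hP _ fun σ hσ => h _ (.disjl hσ)) (hQ _ fun σ hσ => h _ (.disjr hσ))

theorem good_pos (n : Nat) : GoodP (.pos n) := by
  intro Γ h
  have := h _ .at
  rwa [forgetFS] at this

theorem good_down (N : NFm) : GoodP (.down N) := by
  intro Γ h
  have := h _ .down
  rwa [forgetFS] at this

mutual
theorem good_P : ∀ P : PFm, GoodP P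
  | .pos n => good_pos n
  | .tens P Q => good_tens (good_P P) (good_P Q)
  | .rsub P N => good_rsub (good_P P) (good_N N)
  | .lsub N P => good_lsub (good_P P) (good_N N)
  | .disj P Q => good_disj (good_P P) (good_P Q)
  | .down N => good_down N
theorem good_N : ∀ N : NFm, GoodP N.dual
  | .neg n => by rw [NFm.dual]; exact good_pos n
  | .par M N => by rw [NFm.dual]; exact good_tens (good_N N) (good_N M)
  | .ldiv Q M => by
      rw [NFm.dual]
      exact good_rsub (good_N M) (by rw [PFm.dual_dual']; exact good_P Q)
  | .rdiv M Q => by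
      rw [NFm.dual]
      exact good_lsub (good_N M) (by rw [PFm.dual_dual']; exact good_P Q)
  | .conj M N => by rw [NFm.dual]; exact good_disj (good_N N) (good_N M)
  | .up P => by rw [NFm.dual]; exact good_down _
end

/-- Lemma 3.24: for any positive polarized formula P and unpolarized
structure Γ, if `Γ, ⌈σ⌉ ⊢` is derivable for every σ ∈ τ*(P), then `Γ, ⌈P⌉ ⊢` is derivable. -/
theorem forget_positive_inference (P : PFm) (Γ : Str)
    (h : ∀ σ : FStr, Tstar P σ → DSeq false false Γ (forgetFS σ)) :
    DSeq false false Γ (.fm (forgetP P)) := by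
  exact good_P P Γ h
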